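/- Fix an even integer q = 2p with p ≥ 2 and let λ = 2·cos(π/q). Let x ∈ [−λ/2, λ/2) be G_q-irrational, let n ≥ 1 and k ≥ 1, and suppose (t_n, v_n) ∈ D and τ_{k−1} ≤ t_n < τ_k. Then min{Θ_{n−1}(x), Θ_n(x), …, Θ_{n+k(p−1)}(x)} > 1/2, while min{Θ_{n−1}(x), Θ_n(x), …, Θ_{n+k(p−1)+1}(x)} < 1/2. -/

import Mathlib

noncomputable section

open Real Filter Topology MeasureTheory
open scoped Classical

namespace RosenTong

/-- `λ_q = 2 cos(π/q)`. -/
def lam (q : ℕ) : ℝ := 2 * Real.cos (Real.pi / q)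

/-- The Rosen map `f_q` on `[-λ/2, λ/2)`. -/
def f (l : ℝ) (x : ℝ) : ℝ :=
  if x = 0 then 0 else 1 / |x| - l * (⌊1 / (l * |x|) + 1 / 2⌋ : ℝ)

/-- `x` is `G_q`-irrational: its Rosen orbit never hits `0`. -/
def Irr (l : ℝ) (x : ℝ) : Prop := ∀ n : ℕ, (f l)^[n] x ≠ 0

/-- `ε_n = sign (f^{n-1} x)` (for `n ≥ 1`). -/
def eps (l x : ℝ) (n : ℕ) : ℝ := Real.sign ((f l)^[n - 1] x)

/-- `r_n = ⌊1/(λ |f^{n-1} x|) + 1/2⌋` (for `n ≥ 1`), as a real number. -/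
def rr (l x : ℝ) (n : ℕ) : ℝ := (⌊1 / (l * |(f l)^[n - 1] x|) + 1 / 2⌋ : ℝ)

/-- `((R_{n-1}, R_n), (S_{n-1}, S_n))`. -/
def RS (l x : ℝ) : ℕ → (ℝ × ℝ) × (ℝ × ℝ)
  | 0 => ((1, 0), (0, 1))
  | n + 1 =>
      (((RS l x n).1.2, rr l x (n + 1) * l * (RS l x n).1.2 + eps l x (n + 1) * (RS l x n).1.1),
       ((RS l x n).2.2, rr l x (n + 1) * l * (RS l x n).2.2 + eps l x (n + 1) * (RS l x n).2.1))

/-- Numerator `R_n` of the `n`-th Rosen convergent. -/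
def Rnum (l x : ℝ) (n : ℕ) : ℝ := (RS l x n).1.2

/-- Denominator `S_n` of the `n`-th Rosen convergent. -/
def Snum (l x : ℝ) (n : ℕ) : ℝ := (RS l x n).2.2

/-- The approximation coefficient `Θ_n = S_n² |x - R_n/S_n|`. -/
def theta (l x : ℝ) (n : ℕ) : ℝ := (Snum l x n) ^ 2 * |x - Rnum l x n / Snum l x n|

/-- The natural extension map `𝒯(x,y) = (f x, 1/(r(x)λ + ε(x) y))`. -/
def T (l : ℝ) (z : ℝ × ℝ) : ℝ × ℝ :=
  (f l z.1, 1 / ((⌊1 / (l * |z.1|) + 1 / 2⌋ : ℝ) * l + Real.sign z.1 * z.2))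

/-- `(t_n, v_n) = 𝒯^n (x, 0)`. -/
def tv (l x : ℝ) (n : ℕ) : ℝ × ℝ := (T l)^[n] (x, 0)

/-- `G(y) = -1/(λ + y)`. -/
def G (l : ℝ) (y : ℝ) : ℝ := -1 / (l + y)

/-- `C(y) = -1/(2λ + y)`. -/
def CC (l : ℝ) (y : ℝ) : ℝ := -1 / (2 * l + y)

/-- `τ_k` in the even case `q = 2p`. -/
def tauE (l : ℝ) (p : ℕ) : ℕ → ℝ
  | 0 => -2 / (3 * l)
  | k + 1 => -1 / (2 * l + (G l)^[p - 2] (tauE l p k))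

/-- `τ_k` in the odd case `q = 2h+3`. -/
def tauO (l : ℝ) (h : ℕ) : ℕ → ℝ
  | 0 => -2 / (3 * l)
  | k + 1 => CC l ((G l)^[h] (CC l ((G l)^[h - 1] (tauO l h k))))

/-- `φ_j = f^j(-λ/2)`. -/
def phi (l : ℝ) (j : ℕ) : ℝ := (f l)^[j] (-(l / 2))

/-- The heights `L_j` in the even case: `L_1 = 1/(λ+1)`, `L_j = 1/(λ - L_{j-1})`. -/
def LE (l : ℝ) : ℕ → ℝ
  | 0 => 0
  | 1 => 1 / (l + 1)
  | j + 2 => 1 / (l - LE l (j + 1))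

/-- The natural extension domain `Ω` in the even case `q = 2p`. -/
def OmegaE (l : ℝ) (p : ℕ) : Set (ℝ × ℝ) :=
  (⋃ j ∈ Finset.Icc 1 (p - 1),
    (Set.Ico (phi l (j - 1)) (phi l j)) ×ˢ (Set.Icc 0 (LE l j)))
  ∪ (Set.Ico (0 : ℝ) (l / 2)) ×ˢ (Set.Icc (0 : ℝ) 1)

/-- The region `D` (even case): both `Θ_{n-1}` and `Θ_n` exceed `1/2`. -/
def DE (l : ℝ) (p : ℕ) : Set (ℝ × ℝ) :=
  {z ∈ OmegaE l p | z.2 / (1 + z.1 * z.2) > 1 / 2 ∧ |z.1| / (1 + z.1 * z.2) > 1 / 2}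

/-- The region `A = {(t,v) ∈ D : -2/(3λ) ≤ t ≤ -1/(λ+1)}`. -/
def AE (l : ℝ) (p : ℕ) : Set (ℝ × ℝ) :=
  {z ∈ DE l p | -2 / (3 * l) ≤ z.1 ∧ z.1 ≤ -1 / (l + 1)}

/-- `A_k = {(t,v) ∈ A : t ≥ τ_k}`. -/
def AEk (l : ℝ) (p k : ℕ) : Set (ℝ × ℝ) :=
  {z ∈ AE l p | tauE l p k ≤ z.1}

/-- The invariant measure `ν` (even case), with density `C_q/(1+tv)²` on `Ω`. -/
def nuE (q p : ℕ) : Measure (ℝ × ℝ) :=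
  (volume.restrict (OmegaE (lam q) p)).withDensity fun z =>
    ENNReal.ofReal
      ((1 / Real.log ((1 + Real.cos (Real.pi / q)) / Real.sin (Real.pi / q))) /
        (1 + z.1 * z.2) ^ 2)

/-- The Hurwitz constant `H_q` for odd `q`. -/
def Hodd (l : ℝ) : ℝ := 1 / (2 * Real.sqrt ((1 - l / 2) ^ 2 + 1) )

/-- The positive root `R` of `R² + (2-λ)R - 1 = 0` (odd case). -/
def Rodd (l : ℝ) : ℝ := (l - 2 + Real.sqrt ((2 - l) ^ 2 + 4)) / 2

/-- The values `b j = sin (jπ/q) / sin (π/q)` for `q = 2p`, described by the properties used below. -/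
structure IsSineRatio (l : ℝ) (p : ℕ) (b : ℕ → ℝ) : Prop where
  two_le : 2 ≤ p
  zero : b 0 = 0
  one : b 1 = 1
  rec_eq : ∀ j, b (j + 2) = l * b (j + 1) - b j
  lt_succ : ∀ j, j + 1 ≤ p → b j < b (j + 1)
  one_le_sq_sub : ∀ j, j + 1 ≤ p → 1 ≤ b (j + 1) ^ 2 - b j ^ 2
  symm_eq : ∀ j, j + 1 = p → 2 * b j = l * b (j + 1)
  two_le_sq : 2 ≤ l ^ 2
  pos : 0 < l
  lt_two : l < 2

lemma isSineRatio_lam (p : ℕ) (hp : 2 ≤ p) :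
    IsSineRatio (lam (2 * p)) p
      (fun j => Real.sin (j * (π / (2 * p : ℕ))) / Real.sin (π / (2 * p : ℕ))) := by
  set a : ℝ := π / (2 * p : ℕ) with ha
  have hpi := Real.pi_pos
  have hp' : (2 : ℝ) ≤ p := by exact_mod_cast hp
  have hpa : p * a = π / 2 := by
    rw [ha]; push_cast; field_simp
  have ha0 : 0 < a := by rw [ha]; positivity
  have ha4 : a ≤ π / 4 := by nlinarith
  have hs : 0 < Real.sin a := Real.sin_pos_of_pos_of_lt_pi ha0 (by linarith)
  have hl : lam (2 * p) = 2 * Real.cos a := rfl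
  have hle : ∀ j : ℕ, j ≤ p → (j : ℝ) * a ≤ π / 2 := by
    intro j hj
    rw [← hpa]
    have : (j : ℝ) ≤ p := by exact_mod_cast hj
    gcongr
  have hc4 : √2 / 2 ≤ Real.cos a := by
    rw [← Real.cos_pi_div_four]
    exact Real.cos_le_cos_of_nonneg_of_le_pi ha0.le (by linarith) ha4
  have h2 : √2 ^ 2 = 2 := Real.sq_sqrt (by norm_num)
  have h20 : 0 < √2 := by positivity
  refine ⟨hp, by simp, ?_, ?_, ?_, ?_, ?_, ?_, ?_, ?_⟩
  · simp [hs.ne']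
  · intro j
    rw [hl]
    field_simp
    have e1 : ((j + 2 : ℕ) : ℝ) * a = (j + 1 : ℕ) * a + a := by push_cast; ring
    have e2 : (j : ℝ) * a = (j + 1 : ℕ) * a - a := by push_cast; ring
    rw [mul_comm a (j : ℝ), mul_comm a ((j + 1 : ℕ) : ℝ), e1, e2, Real.sin_add, Real.sin_sub]
    ring
  · intro j hj
    apply div_lt_div_of_pos_right _ hs
    have h0 : (0 : ℝ) ≤ j * a := by positivity
    refine Real.sin_lt_sin_of_lt_of_le_pi_div_two (by linarith) (hle _ hj) ?_
    push_cast; linarith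
  · intro j hj
    have h1 := hle _ hj
    push_cast at h1
    have h0 : (0 : ℝ) ≤ j * a := by positivity
    have key : Real.sin ((j + 1 : ℕ) * a) ^ 2 - Real.sin (j * a) ^ 2
        = Real.sin ((2 * j + 1) * a) * Real.sin a := by
      have e1 : ((j + 1 : ℕ) : ℝ) * a = j * a + a := by push_cast; ring
      have e2 : (2 * (j : ℝ) + 1) * a = j * a + (j * a + a) := by ring
      rw [e1, e2, Real.sin_add (j * a) (j * a + a), Real.cos_add, Real.sin_add]
      have A := Real.sin_sq_add_cos_sq (j * a)
      have B := Real.sin_sq_add_cos_sq a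
      have C : Real.cos (j * a) ^ 2 = 1 - Real.sin (j * a) ^ 2 := by linarith
      have D : Real.cos a ^ 2 = 1 - Real.sin a ^ 2 := by linarith
      ring_nf
      rw [C, D]
      ring
    have hge : Real.sin a ≤ Real.sin ((2 * j + 1) * a) := by
      rcases le_total ((2 * j + 1) * a) (π / 2) with h | h
      · exact Real.sin_le_sin_of_le_of_le_pi_div_two (by linarith) h (by nlinarith)
      · rw [← Real.sin_pi_sub ((2 * j + 1) * a)]
        exact Real.sin_le_sin_of_le_of_le_pi_div_two (by linarith) (by linarith) (by linarith)
    simp only [div_pow]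
    rw [← sub_div, key, le_div_iff₀ (by positivity)]
    nlinarith
  · intro j hj
    rw [hl]
    have e : (j : ℝ) * a = π / 2 - a := by
      rw [← hpa, ← hj]; push_cast; ring
    have e' : ((j + 1 : ℕ) : ℝ) * a = π / 2 := by rw [hj, hpa]
    simp only [e, e', Real.sin_pi_div_two, Real.sin_pi_div_two_sub]
    ring
  · rw [hl]; nlinarith
  · rw [hl]; nlinarith
  · rw [hl]
    have : Real.cos a < Real.cos 0 :=
      Real.cos_lt_cos_of_nonneg_of_le_pi le_rfl (by linarith) ha0
    rw [Real.cos_zero] at this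
    linarith

namespace IsSineRatio

variable {l : ℝ} {p : ℕ} {b : ℕ → ℝ}

lemma nonneg (h : IsSineRatio l p b) : ∀ j, j ≤ p → 0 ≤ b j
  | 0, _ => h.zero.ge
  | j + 1, hj => (h.nonneg j (by omega)).trans (h.lt_succ j hj).le

lemma succ_pos (h : IsSineRatio l p b) (j : ℕ) (hj : j + 1 ≤ p) : 0 < b (j + 1) :=
  (h.nonneg j (by omega)).trans_lt (h.lt_succ j hj)

lemma one_lt (h : IsSineRatio l p b) : 1 < l := by
  nlinarith [h.two_le_sq, h.pos]

/-- The top of the natural extension domain over the negative axis is `λ - 1`. -/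
lemma last_height (h : IsSineRatio l p b) (j : ℕ) (hj : j + 2 = p) :
    b (j + 1) + b j = (l - 1) * (b (j + 2) + b (j + 1)) := by
  have h1 := h.symm_eq (j + 1) (by omega)
  have h2 := h.rec_eq j
  rw [show j + 1 + 1 = j + 2 from rfl] at h1
  linarith

end IsSineRatio

/-- The natural extension domain, with heights written through `b`. -/
structure InDomain (l : ℝ) (p : ℕ) (b : ℕ → ℝ) (t v : ℝ) : Prop where
  neg_le : -(l / 2) ≤ t
  lt : t < l / 2
  nonneg : 0 ≤ v
  le_one : v ≤ 1
  height : ∀ i j, i + j + 2 = p → t * b (i + 1) < -b i →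
    v * (b (j + 2) + b (j + 1)) ≤ b (j + 1) + b j

namespace InDomain

variable {l : ℝ} {p : ℕ} {b : ℕ → ℝ} {t v : ℝ}

lemma le_of_neg (hd : InDomain l p b t v) (h : IsSineRatio l p b) (ht : t < 0) :
    v ≤ l - 1 := by
  obtain ⟨j, hj⟩ := Nat.exists_eq_add_of_le h.two_le
  have h1 := hd.height 0 j (by omega) (by simpa [h.zero, h.one] using ht)
  rw [h.last_height j (by omega)] at h1
  have := h.succ_pos (j + 1) (by omega)
  have := h.succ_pos j (by omega)
  exact le_of_mul_le_mul_right h1 (by linarith)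

lemma one_add_mul_pos (hd : InDomain l p b t v) (h : IsSineRatio l p b) : 0 < 1 + t * v := by
  have h1 := mul_le_mul_of_nonneg_right hd.neg_le hd.nonneg
  nlinarith [hd.nonneg, hd.le_one, h.lt_two, h.pos]

end InDomain

/-- The digit of the Rosen expansion. -/
def digit (l t : ℝ) : ℤ := ⌊1 / (l * |t|) + 1 / 2⌋

lemma f_eq {l t : ℝ} (ht : t ≠ 0) : f l t = 1 / |t| - l * digit l t := by
  simp [f, ht, digit]

lemma T_eq (l t v : ℝ) : T l (t, v) = (f l t, 1 / (digit l t * l + Real.sign t * v)) := rfl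

lemma one_le_digit {l t : ℝ} (hl : 0 < l) (hl2 : l < 2) (ht : t ≠ 0) (h : |t| ≤ l / 2) :
    1 ≤ digit l t := by
  rw [digit, Int.le_floor]
  have h0 : 0 < |t| := abs_pos.mpr ht
  have : 1 / 2 ≤ 1 / (l * |t|) := by
    apply one_div_le_one_div_of_le (by positivity)
    nlinarith
  push_cast
  linarith

lemma f_mem {l t : ℝ} (hl : 0 < l) (ht : t ≠ 0) : f l t ∈ Set.Ico (-(l / 2)) (l / 2) := by
  rw [f_eq ht]
  have h0 : 0 < |t| := abs_pos.mpr ht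
  have h1 := Int.floor_le (1 / (l * |t|) + 1 / 2)
  have h2 := Int.lt_floor_add_one (1 / (l * |t|) + 1 / 2)
  rw [← digit] at h1 h2
  have e : 1 / |t| = l * (1 / (l * |t|)) := by field_simp
  rw [e]
  constructor <;> nlinarith

lemma InDomain.one_le_denominator {l : ℝ} {p : ℕ} {b : ℕ → ℝ} {t v : ℝ}
    (hd : InDomain l p b t v) (h : IsSineRatio l p b) (ht : t ≠ 0) :
    1 ≤ digit l t * l + Real.sign t * v ∧
      (2 ≤ digit l t → l + 1 ≤ digit l t * l + Real.sign t * v) := by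
  have hr := one_le_digit h.pos h.lt_two ht (abs_le.mpr ⟨hd.neg_le, hd.lt.le⟩)
  have hl := h.pos
  have hl1 := h.one_lt
  have hr' : (1 : ℝ) ≤ digit l t := by exact_mod_cast hr
  have hv := hd.nonneg
  rcases lt_or_gt_of_ne ht with hneg | hpos
  · have := hd.le_of_neg h hneg
    rw [Real.sign_of_neg hneg]
    refine ⟨by nlinarith, fun h2 => ?_⟩
    have h2' : (2 : ℝ) ≤ digit l t := by exact_mod_cast h2
    nlinarith
  · rw [Real.sign_of_pos hpos]
    refine ⟨by nlinarith, fun h2 => ?_⟩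
    have h2' : (2 : ℝ) ≤ digit l t := by exact_mod_cast h2
    nlinarith

lemma InDomain.map {l : ℝ} {p : ℕ} {b : ℕ → ℝ} {t v : ℝ}
    (hd : InDomain l p b t v) (h : IsSineRatio l p b) (ht : t ≠ 0) :
    InDomain l p b (T l (t, v)).1 (T l (t, v)).2 := by
  have hl := h.pos
  have hl1 := h.one_lt
  obtain ⟨hq1, hq2⟩ := hd.one_le_denominator h ht
  have hr := one_le_digit h.pos h.lt_two ht (abs_le.mpr ⟨hd.neg_le, hd.lt.le⟩)
  obtain ⟨hf1, hf2⟩ := f_mem h.pos ht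
  rw [T_eq]
  dsimp only
  set d := digit l t * l + Real.sign t * v with hdd
  have hd0 : 0 < d := by linarith
  refine ⟨hf1, hf2, by positivity, ?_, ?_⟩
  · rw [div_le_one hd0]; exact hq1
  intro i j hij hlt
  have hbj := h.nonneg j (by omega)
  have hbj1 := h.succ_pos j (by omega)
  have hbi := h.nonneg i (by omega)
  have hbi1 := h.succ_pos i (by omega)
  have hrec := h.rec_eq j
  rw [one_div, inv_mul_le_iff₀ hd0]
  rcases eq_or_lt_of_le hr with hr1 | hr2
  · have hf : f l t = 1 / |t| - l := by rw [f_eq ht, ← hr1]; push_cast; ring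
    rcases lt_or_gt_of_ne ht with hneg | hpos
    · rw [hf, abs_of_neg hneg] at hlt
      have hreci := h.rec_eq i
      have hlt2 : t * b (i + 2) < -b (i + 1) := by
        have h1 : 1 / -t * b (i + 1) < b (i + 2) := by linarith
        rw [one_div, inv_mul_lt_iff₀ (by linarith)] at h1
        linarith
      have hdv : d = l - v := by
        rw [hdd, ← hr1, Real.sign_of_neg hneg]; push_cast; ring
      rcases j with _ | j
      · exfalso
        have hs := h.symm_eq (i + 1) (by omega)
        rw [show i + 1 + 1 = i + 2 from rfl] at hs
        have := h.succ_pos (i + 1) (by omega)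
        rw [show i + 1 + 1 = i + 2 from rfl] at this
        nlinarith [hd.neg_le]
      · have h3 := hd.height (i + 1) j (by omega) hlt2
        have hrecj := h.rec_eq j
        rw [hdv]
        simp only [Nat.add_assoc, Nat.reduceAdd] at *
        nlinarith
    · have hdv : d = l + v := by
        rw [hdd, ← hr1, Real.sign_of_pos hpos]; push_cast; ring
      have hv := hd.nonneg
      rcases j with _ | j
      · exfalso
        rw [hf, abs_of_pos hpos] at hlt
        have hreci := h.rec_eq i
        have hs := h.symm_eq (i + 1) (by omega)
        rw [show i + 1 + 1 = i + 2 from rfl] at hs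
        have h1 : 1 / t * b (i + 1) < b (i + 2) := by linarith
        rw [one_div, inv_mul_lt_iff₀ hpos] at h1
        have := h.succ_pos (i + 1) (by omega)
        rw [show i + 1 + 1 = i + 2 from rfl] at this
        nlinarith [hd.lt]
      · have hrecj := h.rec_eq j
        have := h.nonneg j (by omega)
        rw [hdv]
        simp only [Nat.add_assoc, Nat.reduceAdd] at *
        nlinarith [mul_nonneg hv hbj, mul_nonneg hv hbj1.le]
  · have := hq2 (by omega)
    nlinarith [mul_nonneg hl.le hbj]

lemma tv_succ (l x : ℝ) (m : ℕ) : tv l x (m + 1) = T l (tv l x m) :=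
  Function.iterate_succ_apply' _ _ _

lemma tv_fst (l x : ℝ) (m : ℕ) : (tv l x m).1 = (f l)^[m] x := by
  induction m with
  | zero => rfl
  | succ m ih => rw [tv_succ, Function.iterate_succ_apply', ← ih]; rfl

lemma tv_fst_ne_zero {l x : ℝ} (hirr : Irr l x) (m : ℕ) : (tv l x m).1 ≠ 0 := by
  rw [tv_fst]; exact hirr m

lemma inDomain_tv {l x : ℝ} {p : ℕ} {b : ℕ → ℝ} (h : IsSineRatio l p b)
    (hx : x ∈ Set.Ico (-(l / 2)) (l / 2)) (hirr : Irr l x) (m : ℕ) :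
    InDomain l p b (tv l x m).1 (tv l x m).2 := by
  induction m with
  | zero =>
    refine ⟨hx.1, hx.2, le_rfl, zero_le_one, fun i j hij _ => ?_⟩
    have := h.nonneg j (by omega)
    have := h.nonneg (j + 1) (by omega)
    simp only [tv, Function.iterate_zero, id]
    linarith
  | succ m ih =>
    rw [tv_succ]
    exact ih.map h (tv_fst_ne_zero hirr m)

lemma f_mul_abs {l t : ℝ} (ht : t ≠ 0) : f l t * |t| = 1 - l * digit l t * |t| := by
  have : 0 < |t| := abs_pos.mpr ht
  rw [f_eq ht]
  field_simp

lemma sign_mul_abs_self (t : ℝ) : Real.sign t * |t| = t := by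
  rcases lt_trichotomy t 0 with h | h | h
  · simp [Real.sign_of_neg h, abs_of_neg h]
  · simp [h]
  · simp [Real.sign_of_pos h, abs_of_pos h]

lemma RS_relations {l x : ℝ} {p : ℕ} {b : ℕ → ℝ} (h : IsSineRatio l p b)
    (hx : x ∈ Set.Ico (-(l / 2)) (l / 2)) (hirr : Irr l x) (m : ℕ) :
    0 < (RS l x m).2.2 ∧ (RS l x m).2.1 = (tv l x m).2 * (RS l x m).2.2 ∧
      x * ((RS l x m).2.2 + (tv l x m).1 * (RS l x m).2.1)
        = (RS l x m).1.2 + (tv l x m).1 * (RS l x m).1.1 ∧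
      |(RS l x m).1.1 * (RS l x m).2.2 - (RS l x m).1.2 * (RS l x m).2.1| = 1 := by
  induction m with
  | zero => simp [RS, tv]
  | succ m ih =>
    obtain ⟨h1, h2, h3, h4⟩ := ih
    have ht := tv_fst_ne_zero hirr m
    have hd := inDomain_tv h hx hirr m
    obtain ⟨hq, -⟩ := hd.one_le_denominator h ht
    have hf := f_mul_abs (l := l) ht
    have hr : rr l x (m + 1) = digit l (tv l x m).1 := by
      simp [rr, digit, tv_fst]
    have he : eps l x (m + 1) = Real.sign (tv l x m).1 := by
      simp [eps, tv_fst]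
    have hs : Real.sign (tv l x m).1 * |(tv l x m).1| = (tv l x m).1 := sign_mul_abs_self _
    have hs2 : |Real.sign (tv l x m).1| = 1 := by
      rcases lt_or_gt_of_ne ht with hh | hh
      · simp [Real.sign_of_neg hh]
      · simp [Real.sign_of_pos hh]
    have ha : |(tv l x m).1| ≠ 0 := abs_ne_zero.mpr ht
    rw [tv_succ, show T l (tv l x m) = T l ((tv l x m).1, (tv l x m).2) from rfl, T_eq]
    simp only [RS, hr, he]
    generalize (tv l x m).1 = t at *
    generalize (tv l x m).2 = v at *
    generalize (RS l x m).1.1 = A at *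
    generalize (RS l x m).1.2 = B at *
    generalize (RS l x m).2.1 = C at *
    generalize (RS l x m).2.2 = D at *
    generalize (digit l t : ℝ) = r at *
    generalize Real.sign t = e at *
    generalize f l t = F at *
    generalize |t| = a at *
    subst h2
    have hden : r * l * D + e * (v * D) = (r * l + e * v) * D := by ring
    refine ⟨?_, ?_, ?_, ?_⟩
    · rw [hden]; exact mul_pos (by linarith) h1
    · rw [hden]
      have : r * l + e * v ≠ 0 := by linarith
      field_simp
    · apply mul_right_cancel₀ ha
      subst hs
      linear_combination h3 + (x * D - B) * hf
    · rw [show B * (r * l * D + e * (v * D)) - (r * l * B + e * A) * D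
        = -e * (A * D - B * (v * D)) by ring, abs_mul, h4, abs_neg, hs2, one_mul]

lemma theta_eq {l x : ℝ} {p : ℕ} {b : ℕ → ℝ} (h : IsSineRatio l p b)
    (hx : x ∈ Set.Ico (-(l / 2)) (l / 2)) (hirr : Irr l x) (m : ℕ) :
    theta l x m = |(tv l x m).1| / (1 + (tv l x m).1 * (tv l x m).2) := by
  obtain ⟨h1, h2, h3, h4⟩ := RS_relations h hx hirr m
  have hpos := (inDomain_tv h hx hirr m).one_add_mul_pos h
  rw [theta, Snum, Rnum]
  generalize (tv l x m).1 = t at *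
  generalize (tv l x m).2 = v at *
  generalize (RS l x m).1.1 = A at *
  generalize (RS l x m).1.2 = B at *
  generalize (RS l x m).2.1 = C at *
  generalize (RS l x m).2.2 = D at *
  subst h2
  rw [eq_div_iff hpos.ne']
  have e1 : D ^ 2 * |x - B / D| = |D * (D * x - B)| := by
    rw [show D * (D * x - B) = D ^ 2 * (x - B / D) by field_simp, abs_mul,
      abs_of_pos (show 0 < D ^ 2 by positivity)]
  have e2 : D * (D * x - B) * (1 + t * v) = t * (A * D - B * (v * D)) := by
    linear_combination D * h3
  have e3 := congrArg abs e2
  rw [abs_mul, abs_mul t, h4, mul_one, abs_of_pos hpos] at e3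
  rw [e1, e3]

lemma theta_pred_eq {l x : ℝ} {p : ℕ} {b : ℕ → ℝ} (h : IsSineRatio l p b)
    (hx : x ∈ Set.Ico (-(l / 2)) (l / 2)) (hirr : Irr l x) (m : ℕ) :
    theta l x m = (tv l x (m + 1)).2 / (1 + (tv l x (m + 1)).1 * (tv l x (m + 1)).2) := by
  have ht := tv_fst_ne_zero hirr m
  have hd := inDomain_tv h hx hirr m
  have hpos := hd.one_add_mul_pos h
  have hpos' := (inDomain_tv h hx hirr (m + 1)).one_add_mul_pos h
  obtain ⟨hq, -⟩ := hd.one_le_denominator h ht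
  have hf := f_mul_abs (l := l) ht
  have hs : Real.sign (tv l x m).1 * |(tv l x m).1| = (tv l x m).1 := sign_mul_abs_self _
  rw [theta_eq h hx hirr, div_eq_div_iff hpos.ne' hpos'.ne', tv_succ,
    show T l (tv l x m) = T l ((tv l x m).1, (tv l x m).2) from rfl, T_eq]
  dsimp only
  generalize (tv l x m).1 = t at *
  generalize (tv l x m).2 = v at *
  generalize (digit l t : ℝ) = r at *
  generalize Real.sign t = e at *
  generalize f l t = F at *
  generalize |t| = a at *
  have : r * l + e * v ≠ 0 := by linarith
  field_simp
  linear_combination hf + v * hs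

/-! ### Branches of the Rosen map used during a round -/

lemma neg_one_div_le_iff {a y u : ℝ} (hy : y < 0) (hu : 0 < a + u) :
    -1 / (a + u) ≤ y ↔ u ≤ -1 / y - a := by
  rw [div_le_iff₀ hu, le_sub_iff_add_le, le_div_iff_of_neg hy]
  constructor <;> intro h <;> linarith

lemma lt_neg_one_div_iff {a y u : ℝ} (hy : y < 0) (hu : 0 < a + u) :
    y < -1 / (a + u) ↔ -1 / y - a < u := by
  rw [lt_div_iff₀ hu, sub_lt_iff_lt_add, div_lt_iff_of_neg hy]
  constructor <;> intro h <;> linarith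

lemma digit_eq_of_neg {l t : ℝ} (hl : 0 < l) (ht : t < 0) (r : ℤ)
    (h1 : -(l / 2) ≤ -1 / t - r * l) (h2 : -1 / t - r * l < l / 2) : digit l t = r := by
  rw [digit, abs_of_neg ht, Int.floor_eq_iff]
  have e : -1 / t = l * (1 / (l * -t)) := by field_simp
  rw [e] at h1 h2
  constructor <;> nlinarith

lemma T_eq_of_neg {l t v : ℝ} (hl : 0 < l) (ht : t < 0) (r : ℤ)
    (h1 : -(l / 2) ≤ -1 / t - r * l) (h2 : -1 / t - r * l < l / 2) :
    T l (t, v) = (-1 / t - r * l, 1 / (r * l - v)) := by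
  rw [T_eq, f_eq ht.ne, digit_eq_of_neg hl ht r h1 h2, abs_of_neg ht, Real.sign_of_neg ht]
  ext
  · simp only [one_div, neg_div, inv_neg]; ring
  · dsimp only; congr 1; ring

section Rounds

variable {l : ℝ} {p : ℕ} {b : ℕ → ℝ}

lemma iterate_G_mem (h : IsSineRatio l p b) {a : ℝ} (ha : -1 / l ≤ a) (ha0 : a < 0) (i : ℕ)
    (hi : i + 2 ≤ p) : -b (i + 1) ≤ (G l)^[i] a * b (i + 2) ∧ (G l)^[i] a < 0 := by
  have hl := h.pos
  induction i with
  | zero =>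
    have h2 := h.rec_eq 0
    rw [div_le_iff₀ hl] at ha
    simp only [Nat.zero_add, h.one, h.zero] at *
    exact ⟨by rw [h2]; simpa using ha, ha0⟩
  | succ i ih =>
    obtain ⟨h1, h2⟩ := ih (by omega)
    rw [Function.iterate_succ_apply']
    generalize (G l)^[i] a = y at *
    have hb2 := h.succ_pos (i + 1) (by omega)
    have hb3 := h.succ_pos (i + 2) (by omega)
    have hrec := h.rec_eq (i + 1)
    simp only [Nat.add_assoc, Nat.reduceAdd] at *
    have hy : b (i + 3) ≤ b (i + 2) * (l + y) := by linarith
    have hly : 0 < l + y := pos_of_mul_pos_right (hb3.trans_le hy) hb2.le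
    refine ⟨?_, div_neg_of_neg_of_pos (by norm_num) hly⟩
    rw [G, div_mul_eq_mul_div, le_div_iff₀ hly]
    linarith

lemma neg_half_le_iterate_G (h : IsSineRatio l p b) {a : ℝ} (ha : -1 / l ≤ a) (ha0 : a < 0)
    (i : ℕ) (hi : i + 2 ≤ p) : -(l / 2) ≤ (G l)^[i] a := by
  obtain ⟨h1, -⟩ := iterate_G_mem h ha ha0 i hi
  have hb2 := h.succ_pos (i + 1) (by omega)
  have hrat : 2 * b (i + 1) ≤ l * b (i + 2) := by
    rcases hi.lt_or_eq with hlt | heq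
    · have := h.rec_eq (i + 1)
      have := h.lt_succ (i + 1) (by omega)
      have := h.lt_succ (i + 2) (by omega)
      simp only [Nat.add_assoc, Nat.reduceAdd] at *
      linarith
    · exact (h.symm_eq (i + 1) heq).le
  simp only [Nat.add_assoc, Nat.reduceAdd] at *
  nlinarith

lemma iterate_G_le (h : IsSineRatio l p b) {c : ℝ} (hc : -1 / l ≤ c) (hc1 : c ≤ -1 / (l + 1))
    (i : ℕ) (hi : i + 2 ≤ p) :
    (G l)^[i] c * (b (i + 2) + b (i + 1)) ≤ -(b (i + 1) + b i) := by
  have hl := h.pos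
  have hc0 : c < 0 := hc1.trans_lt (div_neg_of_neg_of_pos (by norm_num) (by linarith))
  induction i with
  | zero =>
    have h2 := h.rec_eq 0
    rw [le_div_iff₀ (by linarith)] at hc1
    simp only [Nat.zero_add, h.one, h.zero] at *
    rw [h2]
    simpa using hc1
  | succ i ih =>
    have h1 := ih (by omega)
    have hlow := neg_half_le_iterate_G h hc hc0 i (by omega)
    rw [Function.iterate_succ_apply']
    generalize (G l)^[i] c = y at *
    have hrec := h.rec_eq (i + 1)
    have hrec0 := h.rec_eq i
    simp only [Nat.add_assoc, Nat.reduceAdd] at *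
    have hly : 0 < l + y := by linarith
    rw [G, div_mul_eq_mul_div, div_le_iff₀ hly]
    linarith

lemma iterate_G_le_one_sub (h : IsSineRatio l p b) {c : ℝ} (hc : -1 / l ≤ c)
    (hc1 : c ≤ -1 / (l + 1)) : (G l)^[p - 2] c ≤ 1 - l := by
  obtain ⟨j, hj⟩ := Nat.exists_eq_add_of_le' h.two_le
  have h1 := iterate_G_le h hc hc1 j (by omega)
  rw [h.last_height j (by omega)] at h1
  have := h.succ_pos (j + 1) (by omega)
  have := h.succ_pos j (by omega)
  rw [show p - 2 = j by omega]
  refine le_of_mul_le_mul_right (a := b (j + 2) + b (j + 1)) ?_ (by linarith)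
  linarith

lemma iterate_G_neg_one_div (h : IsSineRatio l p b) (i : ℕ) (hi : i + 2 ≤ p) :
    (G l)^[i] (-1 / l) * b (i + 2) = -b (i + 1) := by
  have hl := h.pos
  induction i with
  | zero =>
    have h2 := h.rec_eq 0
    simp only [Nat.zero_add, h.one, h.zero] at *
    rw [h2]
    simp [hl.ne']
  | succ i ih =>
    have h1 := ih (by omega)
    have hlow := neg_half_le_iterate_G h le_rfl
      (div_neg_of_neg_of_pos (by norm_num) hl) i (by omega)
    rw [Function.iterate_succ_apply']
    generalize (G l)^[i] (-1 / l) = y at *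
    have hrec := h.rec_eq (i + 1)
    simp only [Nat.add_assoc, Nat.reduceAdd] at *
    have hly : l + y ≠ 0 := by linarith
    rw [G, div_mul_eq_mul_div, div_eq_iff hly]
    linarith

lemma tauE_mem (h : IsSineRatio l p b) (k : ℕ) :
    -2 / (3 * l) ≤ tauE l p k ∧ tauE l p k ≤ -1 / (l + 1) := by
  have hl := h.pos
  have hl2 := h.lt_two
  induction k with
  | zero =>
    refine ⟨le_rfl, ?_⟩
    rw [tauE, div_le_div_iff₀ (by positivity) (by positivity)]
    linarith
  | succ k ih =>
    have h1 : -1 / l ≤ tauE l p k := by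
      refine le_trans ?_ ih.1
      rw [div_le_div_iff₀ (by positivity) (by positivity)]
      linarith
    have h0 : tauE l p k < 0 :=
      ih.2.trans_lt (div_neg_of_neg_of_pos (by norm_num) (by linarith))
    have hlow := neg_half_le_iterate_G h h1 h0 (p - 2) (by have := h.two_le; omega)
    have hup := iterate_G_le_one_sub h h1 ih.2
    rw [tauE]
    constructor <;> rw [div_le_div_iff₀ (by linarith) (by linarith)] <;> linarith

/-- The left end of the interval `[τ_{k-1}, τ_k)`, with `τ_{-1} = -1/λ`. -/
def leftEnd (l : ℝ) (p : ℕ) : ℕ → ℝ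
  | 0 => -1 / l
  | k + 1 => tauE l p k

lemma leftEnd_mem (h : IsSineRatio l p b) (k : ℕ) :
    -1 / l ≤ leftEnd l p k ∧ leftEnd l p k < 0 := by
  have hl := h.pos
  cases k with
  | zero => exact ⟨le_rfl, div_neg_of_neg_of_pos (by norm_num) hl⟩
  | succ k =>
    obtain ⟨h1, h2⟩ := tauE_mem h k
    refine ⟨le_trans ?_ h1, h2.trans_lt (div_neg_of_neg_of_pos (by norm_num) (by linarith))⟩
    rw [div_le_div_iff₀ (by positivity) (by positivity)]
    linarith

lemma tauE_eq_leftEnd (h : IsSineRatio l p b) (k : ℕ) :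
    tauE l p k = -1 / (2 * l + (G l)^[p - 2] (leftEnd l p k)) := by
  have hl := h.pos
  cases k with
  | zero =>
    obtain ⟨j, hj⟩ := Nat.exists_eq_add_of_le' h.two_le
    have h1 := iterate_G_neg_one_div h j (by omega)
    have h2 := h.symm_eq (j + 1) (by omega)
    have h3 := h.succ_pos (j + 1) (by omega)
    simp only [Nat.add_assoc, Nat.reduceAdd] at *
    have h4 : (G l)^[p - 2] (leftEnd l p 0) = -(l / 2) := by
      rw [show p - 2 = j by omega, leftEnd]
      apply mul_right_cancel₀ h3.ne'
      linarith
    rw [h4, tauE, div_eq_div_iff (by positivity) (by linarith)]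
    ring
  | succ k => rfl

/-- Numerators of the orbit of `-s` during a round. -/
def errSeq (l : ℝ) (b : ℕ → ℝ) (s : ℝ) (i : ℕ) : ℝ := (l * b i + b (i + 1)) * s - b i

/-- Denominators along a round started at height `v`. -/
def denSeq (l : ℝ) (b : ℕ → ℝ) (v : ℝ) (i : ℕ) : ℝ := l * b i + b (i + 1) - v * b i

lemma errSeq_rec (h : IsSineRatio l p b) (s : ℝ) (i : ℕ) :
    errSeq l b s (i + 2) = l * errSeq l b s (i + 1) - errSeq l b s i := by
  have h1 := h.rec_eq i
  have h2 := h.rec_eq (i + 1)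
  simp only [errSeq, Nat.add_assoc, Nat.reduceAdd] at *
  rw [h2, h1]
  ring

lemma denSeq_rec (h : IsSineRatio l p b) (v : ℝ) (i : ℕ) :
    denSeq l b v (i + 2) = l * denSeq l b v (i + 1) - denSeq l b v i := by
  have h1 := h.rec_eq i
  have h2 := h.rec_eq (i + 1)
  simp only [denSeq, Nat.add_assoc, Nat.reduceAdd] at *
  rw [h2, h1]
  ring

lemma cassini (h : IsSineRatio l p b) (i : ℕ) : b (i + 1) ^ 2 - b i * b (i + 2) = 1 := by
  induction i with
  | zero => simp [h.zero, h.one]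
  | succ i ih =>
    have h1 := h.rec_eq i
    have h2 := h.rec_eq (i + 1)
    simp only [Nat.add_assoc, Nat.reduceAdd] at *
    rw [h2]
    linear_combination ih + b (i + 2) * h1

lemma errSeq_mul_denSeq_sub (h : IsSineRatio l p b) (s v : ℝ) (i : ℕ) :
    errSeq l b s i * denSeq l b v (i + 1) - errSeq l b s (i + 1) * denSeq l b v i
      = 1 - s * v := by
  have h1 := cassini h i
  simp only [errSeq, denSeq, Nat.add_assoc, Nat.reduceAdd]
  linear_combination (1 - s * v) * h1

lemma errSeq_pos (h : IsSineRatio l p b) {s : ℝ} (hs : 1 < s * (l + 1)) (i : ℕ)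
    (hi : i + 1 ≤ p) : 0 < errSeq l b s i := by
  have hl := h.pos
  have h0 := h.nonneg i (by omega)
  have h1 := h.lt_succ i hi
  have h2 : 0 < l * b i + b (i + 1) := by nlinarith
  refine pos_of_mul_pos_left (b := l + 1) ?_ (by linarith)
  rw [errSeq]
  nlinarith

lemma denSeq_pos (h : IsSineRatio l p b) {v : ℝ} (hv : v ≤ l - 1) (i : ℕ)
    (hi : i + 1 ≤ p) : 0 < denSeq l b v i := by
  have h0 := h.nonneg i (by omega)
  have h1 := h.lt_succ i hi
  rw [denSeq]
  nlinarith

lemma lt_two_mul_errSeq_mul_denSeq (h : IsSineRatio l p b) {s v : ℝ} (hs0 : 0 < s)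
    (hs : 1 < s * (l + 1)) (hv : v ≤ l - 1) (hsv : 1 < s * (v + 2)) (i : ℕ) (hi : i + 2 ≤ p) :
    1 - s * v < 2 * (errSeq l b s (i + 1) * denSeq l b v (i + 1)) := by
  have hQ := h.succ_pos i (by omega)
  have hQN := h.lt_succ (i + 1) (by omega)
  have hsq := h.one_le_sq_sub (i + 1) (by omega)
  simp only [errSeq, denSeq, Nat.add_assoc, Nat.reduceAdd] at *
  generalize b (i + 1) = Q at *
  generalize b (i + 2) = N at *
  obtain ⟨w, rfl⟩ : ∃ w, s = w⁻¹ := ⟨s⁻¹, by simp⟩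
  have hw : 0 < w := inv_pos.mp hs0
  rw [lt_inv_mul_iff₀ hw, mul_one] at hs hsv
  set X := N + Q * (l - w) with hX
  have hX1 : N - Q < X := by nlinarith
  have left_end : 1 < X * (X + 2 * Q) := by nlinarith
  have right_end : 0 < 2 * ((N + Q) * X) - w + l - 1 := by nlinarith
  have key : 0 < 2 * ((l * Q + N - v * Q) * X) - w + v := by
    refine pos_of_mul_pos_left (b := l + 1 - w) ?_ (by linarith)
    have e : (2 * ((l * Q + N - v * Q) * X) - w + v) * (l + 1 - w)
        = (l - 1 - v) * (2 * (X * (X + 2 * Q) - 1))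
          + (v + 2 - w) * (2 * ((N + Q) * X) - w + l - 1) := by
      rw [hX]; ring
    rw [e]
    have t1 : 0 ≤ (l - 1 - v) * (2 * (X * (X + 2 * Q) - 1)) :=
      mul_nonneg (by linarith) (by linarith)
    have t2 : 0 < (v + 2 - w) * (2 * ((N + Q) * X) - w + l - 1) :=
      mul_pos (by linarith) right_end
    linarith
  have e : 2 * (((l * Q + N) * w⁻¹ - Q) * (l * Q + N - v * Q)) - (1 - w⁻¹ * v)
      = w⁻¹ * (2 * ((l * Q + N - v * Q) * X) - w + v) := by
    rw [hX]; field_simp; ring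
  have := mul_pos (inv_pos.mpr hw) key
  linarith

lemma round_state {x : ℝ} (h : IsSineRatio l p b)
    (hx : x ∈ Set.Ico (-(l / 2)) (l / 2)) (hirr : Irr l x) {a c : ℝ}
    (ha : -1 / l ≤ a) (ha0 : a < 0) (hc : -1 / l ≤ c) (hc1 : c ≤ -1 / (l + 1)) (m : ℕ)
    (h1 : -1 / (2 * l + (G l)^[p - 2] a) ≤ (tv l x m).1)
    (h2 : (tv l x m).1 < -1 / (2 * l + (G l)^[p - 2] c))
    (ht1 : (tv l x m).1 < -1 / (l + 1)) (i j : ℕ) (hij : i + j + 2 = p) :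
    (G l)^[j] a ≤ (tv l x (m + i + 1)).1 ∧ (tv l x (m + i + 1)).1 < (G l)^[j] c ∧
      (tv l x (m + i + 1)).1 * errSeq l b (-(tv l x m).1) i
        = -errSeq l b (-(tv l x m).1) (i + 1) ∧
      (tv l x (m + i + 1)).2 * denSeq l b (tv l x m).2 (i + 1)
        = denSeq l b (tv l x m).2 i := by
  have hl := h.pos
  have hl1 := h.one_lt
  have hc0 : c < 0 := hc1.trans_lt (div_neg_of_neg_of_pos (by norm_num) (by linarith))
  have ht0 : (tv l x m).1 < 0 :=
    ht1.trans (div_neg_of_neg_of_pos (by norm_num) (by linarith))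
  have hv := (inDomain_tv h hx hirr m).le_of_neg h ht0
  have hs : 1 < -(tv l x m).1 * (l + 1) := by
    rw [lt_div_iff₀ (by linarith)] at ht1; linarith
  induction i generalizing j with
  | zero =>
    have hA := neg_half_le_iterate_G h ha ha0 j (by omega)
    have hC := neg_half_le_iterate_G h hc hc0 j (by omega)
    obtain ⟨-, hC0⟩ := iterate_G_mem h hc hc0 j (by omega)
    rw [show p - 2 = j by omega] at h1 h2
    rw [neg_one_div_le_iff ht0 (by linarith)] at h1
    rw [lt_neg_one_div_iff ht0 (by linarith)] at h2
    have hT := T_eq_of_neg (v := (tv l x m).2) hl ht0 2 (by push_cast; linarith)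
      (by push_cast; linarith)
    have hb2 := h.rec_eq 0
    simp only [Nat.zero_add, h.one, h.zero] at hb2
    rw [Nat.add_zero, tv_succ, show T l (tv l x m) = T l ((tv l x m).1, (tv l x m).2) from rfl,
      hT]
    push_cast
    refine ⟨h1, h2, ?_, ?_⟩
    · simp only [errSeq, Nat.zero_add, h.one, h.zero, Nat.reduceAdd, hb2]
      have := ht0.ne
      field_simp
      ring
    · simp only [denSeq, Nat.zero_add, h.one, h.zero, Nat.reduceAdd, hb2]
      have : 2 * l - (tv l x m).2 ≠ 0 := by linarith
      field_simp
      ring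
  | succ i ih =>
    obtain ⟨g1, g2, g3, g4⟩ := ih (j + 1) (by omega)
    have hA := neg_half_le_iterate_G h ha ha0 j (by omega)
    have hC := neg_half_le_iterate_G h hc hc0 j (by omega)
    obtain ⟨-, hC0⟩ := iterate_G_mem h hc hc0 j (by omega)
    obtain ⟨-, hC1⟩ := iterate_G_mem h hc hc0 (j + 1) (by omega)
    have hy0 := g2.trans hC1
    have hE := errSeq_rec h (-(tv l x m).1) i
    have hS := denSeq_rec h (tv l x m).2 i
    have hSp := denSeq_pos h hv (i + 1) (by omega)
    have hvy := (inDomain_tv h hx hirr (m + i + 1)).le_of_neg h hy0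
    rw [Function.iterate_succ_apply', G] at g1 g2
    rw [neg_one_div_le_iff hy0 (by linarith)] at g1
    rw [lt_neg_one_div_iff hy0 (by linarith)] at g2
    have hT := T_eq_of_neg (v := (tv l x (m + i + 1)).2) hl hy0 1 (by push_cast; linarith)
      (by push_cast; linarith)
    rw [show m + (i + 1) + 1 = m + i + 1 + 1 by omega, tv_succ,
      show T l (tv l x (m + i + 1)) = T l ((tv l x (m + i + 1)).1, (tv l x (m + i + 1)).2)
        from rfl, hT]
    push_cast
    rw [one_mul]
    rw [show i + 1 + 1 = i + 2 from rfl, hE, hS]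
    refine ⟨g1, g2, ?_, ?_⟩
    · have := hy0.ne
      field_simp
      linear_combination -g3
    · have : l - (tv l x (m + i + 1)).2 ≠ 0 := by linarith
      field_simp
      linear_combination g4

lemma half_lt_theta_of_round {x : ℝ} (h : IsSineRatio l p b)
    (hx : x ∈ Set.Ico (-(l / 2)) (l / 2)) (hirr : Irr l x) {a c : ℝ}
    (ha : -1 / l ≤ a) (ha0 : a < 0) (hc : -1 / l ≤ c) (hc1 : c ≤ -1 / (l + 1)) (m : ℕ)
    (h1 : -1 / (2 * l + (G l)^[p - 2] a) ≤ (tv l x m).1)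
    (h2 : (tv l x m).1 < -1 / (2 * l + (G l)^[p - 2] c))
    (ht1 : (tv l x m).1 < -1 / (l + 1)) (hth : 1 / 2 < theta l x m) (i : ℕ) (hi : i + 2 ≤ p) :
    1 / 2 < theta l x (m + i + 1) := by
  have hl := h.pos
  have hl1 := h.one_lt
  have hc0 : c < 0 := hc1.trans_lt (div_neg_of_neg_of_pos (by norm_num) (by linarith))
  obtain ⟨j, hj⟩ := Nat.exists_eq_add_of_le hi
  obtain ⟨-, g2, g3, g4⟩ := round_state h hx hirr ha ha0 hc hc1 m h1 h2 ht1 i j (by omega)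
  obtain ⟨-, hC0⟩ := iterate_G_mem h hc hc0 j (by omega)
  have ht0 : (tv l x m).1 < 0 :=
    ht1.trans (div_neg_of_neg_of_pos (by norm_num) (by linarith))
  have hd := inDomain_tv h hx hirr m
  have hv := hd.le_of_neg h ht0
  have hs : 1 < -(tv l x m).1 * (l + 1) := by
    rw [lt_div_iff₀ (by linarith)] at ht1; linarith
  rw [theta_eq h hx hirr, lt_div_iff₀ (hd.one_add_mul_pos h), abs_of_neg ht0] at hth
  have hpos' := (inDomain_tv h hx hirr (m + i + 1)).one_add_mul_pos h
  rw [theta_eq h hx hirr, lt_div_iff₀ hpos', abs_of_neg (g2.trans hC0)]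
  have hE0 := errSeq_pos h hs i (by omega)
  have hS1 := denSeq_pos h hv (i + 1) (by omega)
  have hW := errSeq_mul_denSeq_sub h (-(tv l x m).1) (tv l x m).2 i
  have key := lt_two_mul_errSeq_mul_denSeq h (s := -(tv l x m).1) (v := (tv l x m).2)
    (by linarith) hs hv (by linarith) i hi
  generalize (tv l x (m + i + 1)).1 = y at *
  generalize (tv l x (m + i + 1)).2 = u at *
  generalize errSeq l b (-(tv l x m).1) i = E0 at *
  generalize errSeq l b (-(tv l x m).1) (i + 1) = E1 at *
  generalize denSeq l b (tv l x m).2 i = S0 at *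
  generalize denSeq l b (tv l x m).2 (i + 1) = S1 at *
  refine lt_of_mul_lt_mul_right (a := E0 * S1) ?_ (by positivity)
  have e1 : 1 / 2 * (1 + y * u) * (E0 * S1) = 1 / 2 * (1 - -(tv l x m).1 * (tv l x m).2) := by
    linear_combination 1 / 2 * hW + 1 / 2 * (u * S1) * g3 - 1 / 2 * E1 * g4
  have e2 : -y * (E0 * S1) = E1 * S1 := by linear_combination -S1 * g3
  rw [e1, e2]
  linarith

lemma final_inequality (hl : 0 < l) {s v : ℝ} (hs : 2 < 3 * l * s)
    (hv : v ≤ l - 1) (hsv : 1 < s * (v + 2)) :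
    2 * ((1 - l * s) * (l - v)) < 1 - s * v := by
  have hs0 : 0 < s := pos_of_mul_pos_right (a := 3 * l) (by linarith) (by linarith)
  rcases le_or_gt (2 * (1 - l * s) - s) 0 with hneg | hpos
  · have := mul_le_mul_of_nonpos_left hv hneg
    nlinarith
  · have h1 : 0 < (2 * (1 - l * s) - s) * (s * (v + 2) - 1) := mul_pos hpos (by linarith)
    have h2 := sq_nonneg (1 - l * s - s)
    have h3 : 0 < s * (1 - s * v - 2 * ((1 - l * s) * (l - v))) := by nlinarith
    have := pos_of_mul_pos_right h3 hs0.le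
    linarith

lemma theta_succ_lt_half {x : ℝ} (h : IsSineRatio l p b)
    (hx : x ∈ Set.Ico (-(l / 2)) (l / 2)) (hirr : Irr l x) (m : ℕ)
    (h1 : -1 / l ≤ (tv l x m).1) (h2 : (tv l x m).1 < -2 / (3 * l))
    (hth : 1 / 2 < theta l x m) : theta l x (m + 1) < 1 / 2 := by
  have hl := h.pos
  have ht0 : (tv l x m).1 < 0 :=
    h2.trans (div_neg_of_neg_of_pos (by norm_num) (by linarith))
  have hd := inDomain_tv h hx hirr m
  have hv := hd.le_of_neg h ht0
  have hpos := hd.one_add_mul_pos h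
  rw [theta_eq h hx hirr, lt_div_iff₀ hpos, abs_of_neg ht0] at hth
  rw [div_le_iff₀ hl] at h1
  rw [lt_div_iff₀ (by linarith)] at h2
  have hlo : 0 ≤ -1 / (tv l x m).1 - l := by
    rw [sub_nonneg, le_div_iff_of_neg ht0]; linarith
  have hhi : -1 / (tv l x m).1 - l < l / 2 := by
    rw [sub_lt_iff_lt_add, div_lt_iff_of_neg ht0]; linarith
  have hT := T_eq_of_neg (v := (tv l x m).2) hl ht0 1 (by push_cast; linarith)
      (by push_cast; linarith)
  have hpos' := (inDomain_tv h hx hirr (m + 1)).one_add_mul_pos h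
  have key := final_inequality hl (s := -(tv l x m).1) (v := (tv l x m).2)
    (by linarith) hv (by linarith)
  rw [theta_eq h hx hirr, div_lt_iff₀ hpos', tv_succ,
    show T l (tv l x m) = T l ((tv l x m).1, (tv l x m).2) from rfl, hT]
  push_cast
  rw [one_mul, abs_of_nonneg hlo]
  generalize (tv l x m).1 = t at *
  generalize (tv l x m).2 = v at *
  have hlv : 0 < l - v := by linarith
  refine lt_of_mul_lt_mul_right (a := -t * (l - v)) ?_ (mul_nonneg (by linarith) hlv.le)
  have e1 : (-1 / t - l) * (-t * (l - v)) = (1 - l * -t) * (l - v) := by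
    have := ht0.ne
    field_simp
    ring
  have e2 : 1 / 2 * (1 + (-1 / t - l) * (1 / (l - v))) * (-t * (l - v))
      = 1 / 2 * (1 - -t * v) := by
    have := ht0.ne
    have := hlv.ne'
    field_simp
    ring
  rw [e1, e2]
  linarith

lemma theta_of_flushing {x : ℝ} (h : IsSineRatio l p b)
    (hx : x ∈ Set.Ico (-(l / 2)) (l / 2)) (hirr : Irr l x) (k m : ℕ)
    (hth : 1 / 2 < theta l x m) (h1 : leftEnd l p k ≤ (tv l x m).1)
    (h2 : (tv l x m).1 < tauE l p k) :
    (∀ i ≤ k * (p - 1), 1 / 2 < theta l x (m + i)) ∧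
      theta l x (m + k * (p - 1) + 1) < 1 / 2 := by
  have hp := h.two_le
  induction k generalizing m with
  | zero =>
    refine ⟨fun i hi => ?_, ?_⟩
    · obtain rfl : i = 0 := by omega
      exact hth
    · rw [Nat.zero_mul]
      exact theta_succ_lt_half h hx hirr m h1 h2 hth
  | succ k ih =>
    obtain ⟨ha, ha0⟩ := leftEnd_mem h k
    have hc : -1 / l ≤ tauE l p k := (leftEnd_mem h (k + 1)).1
    have hc1 := (tauE_mem h k).2
    have ht1 := h2.trans_le (tauE_mem h (k + 1)).2
    rw [leftEnd, tauE_eq_leftEnd h] at h1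
    rw [tauE] at h2
    have hround := half_lt_theta_of_round h hx hirr ha ha0 hc hc1 m h1 h2 ht1 hth
    obtain ⟨g1, g2, -, -⟩ :=
      round_state h hx hirr ha ha0 hc hc1 m h1 h2 ht1 (p - 2) 0 (by omega)
    obtain ⟨r1, r2⟩ := ih (m + (p - 2) + 1) (hround _ (by omega)) g1 g2
    have hmul : (k + 1) * (p - 1) = (p - 2) + 1 + k * (p - 1) := by
      rw [Nat.add_mul, Nat.one_mul]; omega
    constructor
    · intro i hi
      rw [hmul] at hi
      rcases Nat.lt_or_ge i (p - 1) with hlt | hge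
      · rcases i with _ | i
        · exact hth
        · exact hround i (by omega)
      · have := r1 (i - (p - 1)) (by omega)
        rwa [show m + (p - 2) + 1 + (i - (p - 1)) = m + i by omega] at this
    · rw [hmul]
      rwa [show m + (p - 2) + 1 + k * (p - 1) = m + (p - 2 + 1 + k * (p - 1)) by omega] at r2

end Rounds

/-- flushing after exactly `k` rounds controls blocks of `Θ`'s (even case). -/
theorem flushing_thetas_even (q p : ℕ) (hp : 2 ≤ p) (hq : q = 2 * p)
    (x : ℝ) (hx : x ∈ Set.Ico (-(lam q / 2)) (lam q / 2)) (hirr : Irr (lam q) x)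
    (n k : ℕ) (hn : 1 ≤ n) (hk : 1 ≤ k)
    (hD : tv (lam q) x n ∈ DE (lam q) p)
    (ht1 : tauE (lam q) p (k - 1) ≤ (tv (lam q) x n).1)
    (ht2 : (tv (lam q) x n).1 < tauE (lam q) p k) :
    (∀ i ∈ Finset.range (k * (p - 1) + 2), theta (lam q) x (n - 1 + i) > 1 / 2) ∧
    (∃ i ∈ Finset.range (k * (p - 1) + 3), theta (lam q) x (n - 1 + i) < 1 / 2) := by
  subst hq
  have h := isSineRatio_lam p hp
  obtain ⟨m, rfl⟩ := Nat.exists_eq_add_of_le' hn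
  obtain ⟨k, rfl⟩ := Nat.exists_eq_add_of_le' hk
  obtain ⟨-, hD1, hD2⟩ := hD
  rw [← theta_pred_eq h hx hirr] at hD1
  rw [← theta_eq h hx hirr] at hD2
  obtain ⟨h1, h2⟩ := theta_of_flushing h hx hirr (k + 1) (m + 1) hD2 ht1 ht2
  rw [Nat.add_sub_cancel]
  constructor
  · intro i hi
    rw [Finset.mem_range] at hi
    rcases i with _ | i
    · exact hD1
    · have := h1 i (by omega)
      rwa [show m + 1 + i = m + (i + 1) by omega] at this
  · refine ⟨(k + 1) * (p - 1) + 2, by simp, ?_⟩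
    rwa [show m + ((k + 1) * (p - 1) + 2) = m + 1 + (k + 1) * (p - 1) + 1 by omega]

end RosenTong
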